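/- arXiv:2306.14779 — 2 statements merged into one kernel-verified Lean document; each statement's English description precedes it below -/
import Mathlib

section
/- Let F be a finite set of clauses over n Boolean variables. If the cardinality of F is strictly greater than 3^n - 2^n, then there is no assignment a : Fin n → Bool satisfying every clause of F (the formula is unsatisfiable). -/
/-- If a finite set `F` of clauses over `n` Boolean variables has more than
`3^n - 2^n` clauses, then no assignment satisfies every clause of `F`. -/
theorem unsat_of_card_gt (n : ℕ) (F : Finset (Fin n → Option Bool))
    (hF : ∀ c ∈ F, c ≠ fun _ => none)
    (hcard : 3 ^ n - 2 ^ n < F.card) :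
    ¬ ∃ a : Fin n → Bool, ∀ c ∈ F, ∃ i, c i = some (a i) := by
  rintro ⟨a, ha⟩
  -- the clauses falsified by `a`
  let U : Finset (Fin n → Option Bool) :=
    Fintype.piFinset (fun i => ({none, some (!a i)} : Finset (Option Bool)))
  have hU : U.card = 2 ^ n := by
    simp [U, Fintype.card_piFinset]
  have hd : Disjoint F U := by
    rw [Finset.disjoint_left]
    intro c hc hcU
    obtain ⟨i, hi⟩ := ha c hc
    have h := Fintype.mem_piFinset.mp hcU i
    rw [hi] at h
    simp at h
  have h1 : (F ∪ U).card ≤ 3 ^ n := by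
    have h := Finset.card_le_univ (F ∪ U)
    simpa using h
  rw [Finset.card_union_of_disjoint hd, hU] at h1
  omega
end

section
/- Let n ≥ 1, let F be a finite set of clauses over n Boolean variables, and suppose some assignment a : Fin n → Bool satisfies every clause of F. Then for every variable index i, the number of clauses c in F in which variable i appears (i.e., c i ≠ none, whether positively or negatively) is at most 2·3^(n-1) - 2^(n-1). -/
lemma card_pi_aux (m : ℕ) (i : Fin (m + 1)) (f : Fin (m + 1) → Finset (Option Bool)) (p q : ℕ)
    (hp : (f i).card = p) (hq : ∀ j, j ≠ i → (f j).card = q) :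
    (Fintype.piFinset f).card = p * q ^ m := by
  rw [Fintype.card_piFinset, Fin.prod_univ_succAbove _ i, hp]
  congr 1
  rw [Finset.prod_congr rfl (fun j _ => hq _ (Fin.succAbove_ne i j))]
  simp

/-- In a satisfiable finite set `F` of clauses over `n ≥ 1` variables, each variable
appears (in either polarity) in at most `2·3^(n-1) - 2^(n-1)` clauses of `F`. -/
theorem variable_occurrence_bound (n : ℕ) (hn : 1 ≤ n)
    (F : Finset (Fin n → Option Bool))
    (hF : ∀ c ∈ F, c ≠ fun _ => none)
    (hsat : ∃ a : Fin n → Bool, ∀ c ∈ F, ∃ i, c i = some (a i)) :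
    ∀ i : Fin n, (F.filter fun c => c i ≠ none).card ≤ 2 * 3 ^ (n - 1) - 2 ^ (n - 1) := by
  intro i
  obtain ⟨a, ha⟩ := hsat
  obtain ⟨m, rfl⟩ : ∃ m, n = m + 1 := ⟨n - 1, by omega⟩
  let f : Fin (m + 1) → Finset (Option Bool) :=
    fun j => if j = i then {some true, some false} else Finset.univ
  let g : Fin (m + 1) → Finset (Option Bool) :=
    fun j => if j = i then {some (!a j)} else {none, some (!a j)}
  have hA : (Fintype.piFinset f).card = 2 * 3 ^ m := by
    apply card_pi_aux m i
    · simp [f]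
    · intro j hj
      simp [f, hj]
  have hB : (Fintype.piFinset g).card = 1 * 2 ^ m := by
    apply card_pi_aux m i
    · simp [g]
    · intro j hj
      simp [g, hj]
  have hBA : Fintype.piFinset g ⊆ Fintype.piFinset f := by
    apply Fintype.piFinset_subset
    intro j
    by_cases hj : j = i
    · simp only [f, g, hj, if_true]
      cases a i <;> simp
    · simp [f, hj]
  have hsub : (F.filter fun c => c i ≠ none) ⊆ Fintype.piFinset f \ Fintype.piFinset g := by
    intro c hc
    obtain ⟨hcF, hci⟩ := Finset.mem_filter.mp hc
    rw [Finset.mem_sdiff, Fintype.mem_piFinset, Fintype.mem_piFinset]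
    constructor
    · intro j
      by_cases hj : j = i
      · subst hj
        rcases h : c j with _ | _ | _ <;> simp_all [f]
      · simp [f, hj]
    · intro h
      obtain ⟨j, hj⟩ := ha c hcF
      have := h j
      rw [hj] at this
      by_cases hji : j = i <;> simp [g, hji] at this
  have := Finset.card_le_card hsub
  rw [Finset.card_sdiff_of_subset hBA, hA, hB, one_mul] at this
  simpa using this
end
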